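/- Let G be a planar 3-tree that has a construction sequence v1,…,vn such that every face f in its dual face tree satisfies gd(f) ≤ 2. Then G admits a plane proper arc diagram (that is, a 2-page book embedding, so in particular G is subhamiltonian). -/

import Mathlib

open Set Bornology

noncomputable section

/-! ### Plane drawings, planarity, and triangulations

A drawing of a simple graph in the plane: vertices are distinct points, edges are
simple continuous curves between their endpoints, interiors of edges avoid vertices,
and distinct edges have disjoint interiors (no two edges cross or touch). -/

structure PlaneDrawing {V : Type} (G : SimpleGraph V) where
  vert : V → ℝ × ℝ
  edge : Sym2 V → ℝ → ℝ × ℝ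
  vert_inj : Function.Injective vert
  edge_cont : ∀ e ∈ G.edgeSet, ContinuousOn (edge e) (Set.Icc 0 1)
  edge_injOn : ∀ e ∈ G.edgeSet, Set.InjOn (edge e) (Set.Icc 0 1)
  edge_ends : ∀ a b : V, G.Adj a b →
    ({edge s(a, b) 0, edge s(a, b) 1} : Set (ℝ × ℝ)) = {vert a, vert b}
  edge_int_vert : ∀ e ∈ G.edgeSet, ∀ x : V, vert x ∉ edge e '' Set.Ioo 0 1
  edge_disjoint : ∀ e ∈ G.edgeSet, ∀ f ∈ G.edgeSet, e ≠ f →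
    edge e '' Set.Ioo 0 1 ∩ edge f '' Set.Ioo 0 1 = ∅

/-- A graph is planar if it admits a crossing-free drawing in the plane. -/
def IsPlanar {V : Type} (G : SimpleGraph V) : Prop := Nonempty (PlaneDrawing G)

/-- A (plane) triangulation: a maximal planar graph on at least three vertices. -/
def IsTriangulation {V : Type} [Fintype V] (G : SimpleGraph V) : Prop :=
  3 ≤ Fintype.card V ∧ IsPlanar G ∧
    ∀ a b : V, a ≠ b → ¬ G.Adj a b →
      ¬ IsPlanar (G ⊔ SimpleGraph.fromEdgeSet {s(a, b)})

/-- The edges of `G` with both endpoints in `W`. -/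
def edgesWithin {V : Type} (G : SimpleGraph V) (W : Set V) : Set (Sym2 V) :=
  {e | e ∈ G.edgeSet ∧ ∀ x ∈ e, x ∈ W}

/-- The neighbours of `x` that lie in `W`. -/
def nbrsIn {V : Type} (G : SimpleGraph V) (W : Set V) (x : V) : Set V :=
  {y | y ∈ W ∧ G.Adj x y}

namespace PlaneDrawing

variable {V : Type} {G : SimpleGraph V}

def edgeImage (D : PlaneDrawing G) (e : Sym2 V) : Set (ℝ × ℝ) :=
  D.edge e '' Set.Icc 0 1

/-- The union of all vertex points and edge curves of the sub-drawing induced by `W`. -/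
def imageOn (D : PlaneDrawing G) (W : Set V) : Set (ℝ × ℝ) :=
  D.vert '' W ∪ ⋃ e ∈ edgesWithin G W, D.edgeImage e

/-- The outer face `F∘` of the sub-drawing induced by `W`: the union of the unbounded
connected components of the complement of the drawing. -/
def outerRegion (D : PlaneDrawing G) (W : Set V) : Set (ℝ × ℝ) :=
  {p | p ∉ D.imageOn W ∧ ¬ IsBounded (connectedComponentIn (D.imageOn W)ᶜ p)}

/-- The vertex `x` lies on the boundary cycle `C∘` of the outer face of `G[W]`. -/
def OnOuterVertex (D : PlaneDrawing G) (W : Set V) (x : V) : Prop :=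
  D.vert x ∈ frontier (D.outerRegion W)

/-- The edge `e` lies on the boundary cycle `C∘` of the outer face of `G[W]`. -/
def OnOuterEdge (D : PlaneDrawing G) (W : Set V) (e : Sym2 V) : Prop :=
  e ∈ edgesWithin G W ∧ D.edgeImage e ⊆ frontier (D.outerRegion W)

/-- The triangle `abc` bounds a face of the full drawing. -/
def IsFacialTriangle (D : PlaneDrawing G) (a b c : V) : Prop :=
  G.Adj a b ∧ G.Adj b c ∧ G.Adj a c ∧
    ∃ p, p ∉ D.imageOn Set.univ ∧
      frontier (connectedComponentIn (D.imageOn Set.univ)ᶜ p) =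
        D.edgeImage s(a, b) ∪ D.edgeImage s(b, c) ∪ D.edgeImage s(a, c)

/-- Every inner (bounded) face of the sub-drawing induced by `W` is bounded by a
triangle of `G[W]`. -/
def InnerFacesTriangulated (D : PlaneDrawing G) (W : Set V) : Prop :=
  ∀ p, p ∉ D.imageOn W → IsBounded (connectedComponentIn (D.imageOn W)ᶜ p) →
    ∃ a ∈ W, ∃ b ∈ W, ∃ c ∈ W, G.Adj a b ∧ G.Adj b c ∧ G.Adj a c ∧
      frontier (connectedComponentIn (D.imageOn W)ᶜ p) =
        D.edgeImage s(a, b) ∪ D.edgeImage s(b, c) ∪ D.edgeImage s(a, c)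

end PlaneDrawing

/-- A graph is biconnected if it is connected and has no cut vertex. -/
def Biconnected {α : Type} (H : SimpleGraph α) : Prop :=
  H.Connected ∧ ∀ x : α, (H.induce {y | y ≠ x}).Connected

/-- The subgraph of `G` induced by `W` (with the drawing `D`) is internally
triangulated: biconnected and every inner face is a triangle. -/
def InternallyTriangulatedOn {V : Type} {G : SimpleGraph V}
    (D : PlaneDrawing G) (W : Set V) : Prop :=
  Biconnected (G.induce W) ∧ D.InnerFacesTriangulated W

/-! ### Canonical orderings -/

/-- The vertex set `V_i = {v 1, …, v i}`. -/
def Vset {V : Type} (v : ℕ → V) (i : ℕ) : Set V := v '' Set.Icc 1 i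

/-- `v 1, …, v i` is a canonical ordering for `G_i` (conditions (C1)–(C3)). -/
def IsCanonicalOrdering {V : Type} {G : SimpleGraph V} (D : PlaneDrawing G)
    (i : ℕ) (v : ℕ → V) : Prop :=
  3 ≤ i ∧ Set.InjOn v (Set.Icc 1 i) ∧ G.Adj (v 1) (v 2) ∧
    ∀ m, 3 ≤ m → m ≤ i →
      InternallyTriangulatedOn D (Vset v m) ∧
      D.OnOuterEdge (Vset v m) s(v 1, v 2) ∧
      ∀ j, m < j → j ≤ i → D.vert (v j) ∈ D.outerRegion (Vset v m)

/-- The canonical ordering `v 1, …, v i` is extensible: it can be completed to a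
canonical ordering of the whole graph. -/
def ExtensibleOrd {V : Type} [Fintype V] {G : SimpleGraph V} (D : PlaneDrawing G)
    (i : ℕ) (v : ℕ → V) : Prop :=
  ∃ w : ℕ → V, (∀ m, 1 ≤ m → m ≤ i → w m = v m) ∧
    Set.BijOn w (Set.Icc 1 (Fintype.card V)) Set.univ ∧
    IsCanonicalOrdering D (Fintype.card V) w

/-- Append `x` to the sequence `v` at position `i + 1`. -/
def extendSeq {V : Type} (v : ℕ → V) (i : ℕ) (x : V) : ℕ → V :=
  fun m => if m = i + 1 then x else v m

/-- A vertex `x ∉ V_i` is eligible for `G_i` if appending it yields an extensible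
canonical ordering for `G_{i+1}`. -/
def Eligible {V : Type} [Fintype V] {G : SimpleGraph V} (D : PlaneDrawing G)
    (i : ℕ) (v : ℕ → V) (x : V) : Prop :=
  x ∉ Vset v i ∧ IsCanonicalOrdering D (i + 1) (extendSeq v i x) ∧
    ExtensibleOrd D (i + 1) (extendSeq v i x)

open Classical in
/-- The region `R_i(x)` associated to a vertex `x ∉ W` (with `W = V_i`): the outer
face of `G[W]` if `x` has at most one neighbour in `W`, and otherwise the part of the
outer face cut off from infinity by the edges from `x` to its neighbours on the
outer path. -/
def Rregion {V : Type} {G : SimpleGraph V} (D : PlaneDrawing G)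
    (W : Set V) (x : V) : Set (ℝ × ℝ) :=
  if (nbrsIn G W x).Subsingleton then D.outerRegion W
  else
    {p | p ∈ D.outerRegion W ∧
      p ∉ (⋃ y ∈ nbrsIn G W x, D.edgeImage s(x, y)) ∧
      IsBounded (connectedComponentIn
        (D.imageOn W ∪ ⋃ y ∈ nbrsIn G W x, D.edgeImage s(x, y))ᶜ p)}

/-- The open region `X_j` spanned by `u` and the part of the outer path between two
consecutive neighbours `a`, `b` of `u`. -/
def Xregion {V : Type} {G : SimpleGraph V} (D : PlaneDrawing G)
    (W : Set V) (u a b : V) : Set (ℝ × ℝ) :=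
  {p | p ∈ D.outerRegion W ∧
    p ∉ D.edgeImage s(u, a) ∪ D.edgeImage s(u, b) ∧
    IsBounded (connectedComponentIn
      (D.imageOn W ∪ D.edgeImage s(u, a) ∪ D.edgeImage s(u, b))ᶜ p)}

/-! ### Arc diagrams

Vertices are placed on a horizontal spine.  Every edge is drawn as a *mountain*
(a proper arc, i.e. halfcircle, above the spine), a *pocket* (a proper arc below the
spine), or a *down-up biarc* (two halfcircles, crossing the spine exactly once, the
left halfcircle below and the right halfcircle above the spine).  In particular all
edges are x-monotone and every biarc is down-up monotone.  Each edge also carries an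
amount of credits (used only for the credit-scheme lemmas). -/

inductive ArcKind : Type
  | mountain
  | pocket
  | biarc
deriving DecidableEq

structure ArcDiagram (V : Type) where
  pos : V → ℝ
  kind : Sym2 V → ArcKind
  crossPt : Sym2 V → ℝ
  credit : Sym2 V → ℝ

/-- Two intervals interleave (so that halfcircles over them on the same side of the
spine cross). -/
def Interleaved (p q : ℝ × ℝ) : Prop := p.1 < q.1 ∧ q.1 < p.2 ∧ p.2 < q.2

/-- The height above (or depth below) the spine, at abscissa `x`, of the halfcircle
with diameter from `l` to `r` centered on the spine. -/
def arcHeight (l r x : ℝ) : ℝ := Real.sqrt (((r - l) / 2) ^ 2 - (x - (l + r) / 2) ^ 2)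

namespace ArcDiagram

variable {V : Type}

def lo (A : ArcDiagram V) (e : Sym2 V) : ℝ :=
  Sym2.lift ⟨fun a b => min (A.pos a) (A.pos b), fun _ _ => min_comm _ _⟩ e

def hi (A : ArcDiagram V) (e : Sym2 V) : ℝ :=
  Sym2.lift ⟨fun a b => max (A.pos a) (A.pos b), fun _ _ => max_comm _ _⟩ e

/-- The halfcircles of the edge `e` above the spine (as intervals on the spine). -/
def upperArcs (A : ArcDiagram V) (e : Sym2 V) : List (ℝ × ℝ) :=
  match A.kind e with
  | ArcKind.mountain => [(A.lo e, A.hi e)]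
  | ArcKind.pocket => []
  | ArcKind.biarc => [(A.crossPt e, A.hi e)]

/-- The halfcircles of the edge `e` below the spine (as intervals on the spine). -/
def lowerArcs (A : ArcDiagram V) (e : Sym2 V) : List (ℝ × ℝ) :=
  match A.kind e with
  | ArcKind.mountain => []
  | ArcKind.pocket => [(A.lo e, A.hi e)]
  | ArcKind.biarc => [(A.lo e, A.crossPt e)]

/-- `A` is a plane arc diagram of the subgraph of `G` induced by `W`: vertex
positions on the spine are distinct, spine crossings of biarcs are in the interior
of the edge's span and distinct from all vertices and from each other, and no two
halfcircles on the same side of the spine cross. -/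
def IsPlaneOn (A : ArcDiagram V) (G : SimpleGraph V) (W : Set V) : Prop :=
  Set.InjOn A.pos W ∧
  (∀ e ∈ edgesWithin G W, A.kind e = ArcKind.biarc →
      A.lo e < A.crossPt e ∧ A.crossPt e < A.hi e ∧ ∀ x ∈ W, A.crossPt e ≠ A.pos x) ∧
  (∀ e ∈ edgesWithin G W, ∀ f ∈ edgesWithin G W, e ≠ f →
      A.kind e = ArcKind.biarc → A.kind f = ArcKind.biarc → A.crossPt e ≠ A.crossPt f) ∧
  (∀ e ∈ edgesWithin G W, ∀ f ∈ edgesWithin G W, e ≠ f →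
      (∀ p ∈ A.upperArcs e, ∀ q ∈ A.upperArcs f, ¬ Interleaved p q) ∧
      (∀ p ∈ A.lowerArcs e, ∀ q ∈ A.lowerArcs f, ¬ Interleaved p q))

/-- The number of biarcs of the diagram (on the subgraph induced by `W`). -/
def biarcCount (A : ArcDiagram V) (G : SimpleGraph V) (W : Set V) : ℕ :=
  {e | e ∈ edgesWithin G W ∧ A.kind e = ArcKind.biarc}.ncard

/-- The cost of the diagram: the total amount of credits on its edges. -/
def cost (A : ArcDiagram V) (G : SimpleGraph V) (W : Set V) : ℝ :=
  ∑ᶠ e ∈ edgesWithin G W, A.credit e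

/-- The edge `e` is (partly) vertically visible from above. -/
def OnUpperEnvelope (A : ArcDiagram V) (G : SimpleGraph V) (W : Set V)
    (e : Sym2 V) : Prop :=
  e ∈ edgesWithin G W ∧ ∃ p ∈ A.upperArcs e, ∃ x : ℝ, p.1 < x ∧ x < p.2 ∧
    ∀ f ∈ edgesWithin G W, f ≠ e → ∀ q ∈ A.upperArcs f, q.1 < x → x < q.2 →
      arcHeight q.1 q.2 x < arcHeight p.1 p.2 x

/-- The edge `e` is (partly) vertically visible from below. -/
def OnLowerEnvelope (A : ArcDiagram V) (G : SimpleGraph V) (W : Set V)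
    (e : Sym2 V) : Prop :=
  e ∈ edgesWithin G W ∧ ∃ p ∈ A.lowerArcs e, ∃ x : ℝ, p.1 < x ∧ x < p.2 ∧
    ∀ f ∈ edgesWithin G W, f ≠ e → ∀ q ∈ A.lowerArcs f, q.1 < x → x < q.2 →
      arcHeight q.1 q.2 x < arcHeight p.1 p.2 x

end ArcDiagram

/-! ### The invariants (I1)–(I5) of valid resp. extensible arc diagrams -/

/-- Invariants (I1)–(I4): `A` is a valid arc diagram for the subgraph of `G` induced
by `W` (relative to the plane embedding `D` of `G`, the starting vertices `v1, v2`,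
and the constant `χ`).  (I1) every edge is a proper arc or a down-up biarc and every
edge on the upper envelope is a proper arc; (I2) every mountain whose left endpoint
lies on `C∘(G[W]) \ {v2}` carries one credit; (I3) every biarc carries one credit;
(I4) every pocket on `P∘(G[W])` carries `χ` credits. -/
def ValidDiagram {V : Type} {G : SimpleGraph V} (D : PlaneDrawing G)
    (W : Set V) (v1 v2 : V) (χ : ℝ) (A : ArcDiagram V) : Prop :=
  A.IsPlaneOn G W ∧
  (∀ e ∈ edgesWithin G W, 0 ≤ A.credit e) ∧
  (∀ e, A.OnUpperEnvelope G W e → A.kind e ≠ ArcKind.biarc) ∧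
  (∀ a b : V, a ∈ W → b ∈ W → G.Adj a b → A.kind s(a, b) = ArcKind.mountain →
      A.pos a < A.pos b → D.OnOuterVertex W a → a ≠ v2 → 1 ≤ A.credit s(a, b)) ∧
  (∀ e ∈ edgesWithin G W, A.kind e = ArcKind.biarc → 1 ≤ A.credit e) ∧
  (∀ e ∈ edgesWithin G W, A.kind e = ArcKind.pocket → D.OnOuterEdge W e →
      e ≠ s(v1, v2) → χ ≤ A.credit e)

/-- Invariants (I1)–(I5): additionally `v1` is leftmost and `v2` rightmost on the
spine, the edge `v1 v2` forms the lower envelope, and the edges of `P∘(G[W])` form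
the upper envelope. -/
def ExtensibleDiagram {V : Type} {G : SimpleGraph V} (D : PlaneDrawing G)
    (W : Set V) (v1 v2 : V) (χ : ℝ) (A : ArcDiagram V) : Prop :=
  ValidDiagram D W v1 v2 χ A ∧ v1 ∈ W ∧ v2 ∈ W ∧
  (∀ w ∈ W, w ≠ v1 → A.pos v1 < A.pos w) ∧
  (∀ w ∈ W, w ≠ v2 → A.pos w < A.pos v2) ∧
  (∀ e ∈ edgesWithin G W, (A.OnLowerEnvelope G W e ↔ e = s(v1, v2))) ∧
  (∀ e ∈ edgesWithin G W, (A.OnUpperEnvelope G W e ↔ D.OnOuterEdge W e ∧ e ≠ s(v1, v2)))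

/-! ### Profiles, problematic vertices, pivots and the covering relation -/

/-- `x` has type `T(2, ⌢)`: degree two in `G_{i+1}` and its profile is a single
mountain. -/
def TypeT2 {V : Type} (A : ArcDiagram V) (G : SimpleGraph V) (W : Set V)
    (x : V) : Prop :=
  ∃ a b : V, nbrsIn G W x = {a, b} ∧ A.pos a < A.pos b ∧ G.Adj a b ∧
    A.kind s(a, b) = ArcKind.mountain

/-- `x` has type `T(3, ⌢⌢)`. -/
def TypeT3mm {V : Type} (A : ArcDiagram V) (G : SimpleGraph V) (W : Set V)
    (x : V) : Prop :=
  ∃ a b c : V, nbrsIn G W x = {a, b, c} ∧ A.pos a < A.pos b ∧ A.pos b < A.pos c ∧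
    G.Adj a b ∧ G.Adj b c ∧
    A.kind s(a, b) = ArcKind.mountain ∧ A.kind s(b, c) = ArcKind.mountain

/-- `x` has type `T(4, ⌢⌢⌢)`. -/
def TypeT4 {V : Type} (A : ArcDiagram V) (G : SimpleGraph V) (W : Set V)
    (x : V) : Prop :=
  ∃ a b c d : V, nbrsIn G W x = {a, b, c, d} ∧
    A.pos a < A.pos b ∧ A.pos b < A.pos c ∧ A.pos c < A.pos d ∧
    G.Adj a b ∧ G.Adj b c ∧ G.Adj c d ∧
    A.kind s(a, b) = ArcKind.mountain ∧ A.kind s(b, c) = ArcKind.mountain ∧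
    A.kind s(c, d) = ArcKind.mountain

/-- `x` has type `T(3, ⌢⌣)`. -/
def TypeT3ms {V : Type} (A : ArcDiagram V) (G : SimpleGraph V) (W : Set V)
    (x : V) : Prop :=
  ∃ a b c : V, nbrsIn G W x = {a, b, c} ∧ A.pos a < A.pos b ∧ A.pos b < A.pos c ∧
    G.Adj a b ∧ G.Adj b c ∧
    A.kind s(a, b) = ArcKind.mountain ∧ A.kind s(b, c) = ArcKind.pocket

/-- An eligible vertex is problematic if it has one of the four types
`T(2,⌢)`, `T(3,⌢⌢)`, `T(4,⌢⌢⌢)`, `T(3,⌢⌣)`. -/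
def Problematic {V : Type} (A : ArcDiagram V) (G : SimpleGraph V) (W : Set V)
    (x : V) : Prop :=
  TypeT2 A G W x ∨ TypeT3mm A G W x ∨ TypeT4 A G W x ∨ TypeT3ms A G W x

def HasLeftPivotType {V : Type} (A : ArcDiagram V) (G : SimpleGraph V) (W : Set V)
    (x : V) : Prop :=
  TypeT2 A G W x ∨ TypeT3mm A G W x ∨ TypeT4 A G W x

def HasRightPivotType {V : Type} (A : ArcDiagram V) (G : SimpleGraph V) (W : Set V)
    (x : V) : Prop :=
  TypeT3ms A G W x

def IsLeftmostNbr {V : Type} (A : ArcDiagram V) (G : SimpleGraph V) (W : Set V)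
    (x l : V) : Prop :=
  l ∈ nbrsIn G W x ∧ ∀ y ∈ nbrsIn G W x, A.pos l ≤ A.pos y

def IsRightmostNbr {V : Type} (A : ArcDiagram V) (G : SimpleGraph V) (W : Set V)
    (x r : V) : Prop :=
  r ∈ nbrsIn G W x ∧ ∀ y ∈ nbrsIn G W x, A.pos y ≤ A.pos r

/-- `q` is the pivot `p(x)` of the problematic vertex `x`: its rightmost neighbour on
the outer path if `x` has right pivot type `T(3,⌢⌣)`, its leftmost neighbour
otherwise. -/
def IsPivot {V : Type} (A : ArcDiagram V) (G : SimpleGraph V) (W : Set V)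
    (x q : V) : Prop :=
  (HasRightPivotType A G W x ∧ IsRightmostNbr A G W x q) ∨
  (HasLeftPivotType A G W x ∧ IsLeftmostNbr A G W x q)

/-- `z = pc(x)`: the vertex covering the pivot edge `x·p(x)`, i.e. the vertex outside
`W ∪ {x}` forming a triangular face of `G` with this edge. -/
def PivotCover {V : Type} {G : SimpleGraph V} (D : PlaneDrawing G) (A : ArcDiagram V)
    (W : Set V) (x z : V) : Prop :=
  z ∉ W ∧ z ≠ x ∧ ∃ q : V, IsPivot A G W x q ∧ D.IsFacialTriangle x q z

/-- `z` covers the edge `e` of the outer path: `z ∉ W` forms a triangular face of `G`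
with the two endpoints of `e`. -/
def CoversEdge {V : Type} {G : SimpleGraph V} (D : PlaneDrawing G)
    (W : Set V) (z : V) (e : Sym2 V) : Prop :=
  z ∉ W ∧ ∃ a b : V, e = s(a, b) ∧ D.IsFacialTriangle a b z

/-- `a` and `b` are consecutive neighbours (from left to right) of `x` in `W`. -/
def ConsecNbrs {V : Type} (A : ArcDiagram V) (G : SimpleGraph V) (W : Set V)
    (x a b : V) : Prop :=
  a ∈ nbrsIn G W x ∧ b ∈ nbrsIn G W x ∧ A.pos a < A.pos b ∧
    ∀ c ∈ nbrsIn G W x, ¬ (A.pos a < A.pos c ∧ A.pos c < A.pos b)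

/-- `e` is an edge of the profile `pr(x)`: an edge of the outer path between two
consecutive neighbours of `x`. -/
def ProfileEdge {V : Type} (A : ArcDiagram V) (G : SimpleGraph V) (W : Set V)
    (x : V) (e : Sym2 V) : Prop :=
  ∃ a b : V, e = s(a, b) ∧ ConsecNbrs A G W x a b ∧ G.Adj a b

/-! ### Construction sequences of planar 3-trees and their dual face trees -/

/-- A construction sequence of a planar 3-tree `G`: starting from the triangle on the
first three vertices, each subsequent vertex `ord j` is inserted into a face `F j`
(a triangle of three earlier vertices that was created earlier and not yet
subdivided) and joined to its three vertices. -/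
structure P3TConstruction (V : Type) [Fintype V] [DecidableEq V]
    (G : SimpleGraph V) where
  n : ℕ
  three_le : 3 ≤ n
  card_eq : Fintype.card V = n
  ord : Fin n ≃ V
  F : Fin n → Finset V
  adj_base : ∀ i j : Fin n, (i : ℕ) < 3 → (j : ℕ) < 3 → (G.Adj (ord i) (ord j) ↔ i ≠ j)
  adj_ins : ∀ j : Fin n, 3 ≤ (j : ℕ) → ∀ i : Fin n, i < j →
    (G.Adj (ord i) (ord j) ↔ ord i ∈ F j)
  F_card : ∀ j : Fin n, 3 ≤ (j : ℕ) → (F j).card = 3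
  F_sub : ∀ j : Fin n, 3 ≤ (j : ℕ) → ∀ u ∈ F j, ∃ i : Fin n, i < j ∧ ord i = u
  F_inj : ∀ j k : Fin n, 3 ≤ (j : ℕ) → 3 ≤ (k : ℕ) → F j = F k → j = k
  F_created : ∀ j : Fin n, 3 ≤ (j : ℕ) →
    F j = {ord ⟨0, Nat.lt_of_lt_of_le (by norm_num) three_le⟩,
           ord ⟨1, Nat.lt_of_lt_of_le (by norm_num) three_le⟩,
           ord ⟨2, Nat.lt_of_lt_of_le (by norm_num) three_le⟩} ∨
      ∃ i : Fin n, i < j ∧ 3 ≤ (i : ℕ) ∧ ∃ x ∈ F i, F j = insert (ord i) ((F i).erase x)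

namespace P3TConstruction

variable {V : Type} [Fintype V] [DecidableEq V] {G : SimpleGraph V}

/-- The root face `v1 v2 v3` of the dual face tree. -/
def rootFace (C : P3TConstruction V G) : Finset V :=
  {C.ord ⟨0, Nat.lt_of_lt_of_le (by norm_num) C.three_le⟩,
   C.ord ⟨1, Nat.lt_of_lt_of_le (by norm_num) C.three_le⟩,
   C.ord ⟨2, Nat.lt_of_lt_of_le (by norm_num) C.three_le⟩}

/-- The child face of `F j` obtained by replacing its vertex `x` with `ord j`. -/
def childFace (C : P3TConstruction V G) (j : Fin C.n) (x : V) : Finset V :=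
  insert (C.ord j) ((C.F j).erase x)

/-- A face is internal (has a face vertex, i.e. is subdivided at some point, i.e. is
active at some point) iff some vertex is inserted into it. -/
def IsInternalFace (C : P3TConstruction V G) (f : Finset V) : Prop :=
  ∃ j : Fin C.n, 3 ≤ (j : ℕ) ∧ C.F j = f

/-- `g` is a child of `f` in the dual face tree. -/
def IsChildOf (C : P3TConstruction V G) (g f : Finset V) : Prop :=
  ∃ j : Fin C.n, 3 ≤ (j : ℕ) ∧ C.F j = f ∧ ∃ x ∈ C.F j, g = C.childFace j x

/-- `f` is a node of the dual face tree `𝒯`. -/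
def IsFace (C : P3TConstruction V G) (f : Finset V) : Prop :=
  f = C.rootFace ∨ ∃ f' : Finset V, C.IsChildOf f f'

/-- The grand-degree of a face: the maximal number of active child faces over the
whole construction, i.e. the number of its internal (non-leaf) children in `𝒯`. -/
def gd (C : P3TConstruction V G) (f : Finset V) : ℕ :=
  {g : Finset V | C.IsChildOf g f ∧ C.IsInternalFace g}.ncard

end P3TConstruction

/-- `G` is a Kleetope over the sub-triangulation on the vertex set `S`: both `G` and
`G[S]` are plane triangulations, every vertex outside `S` has exactly the three
vertices of a triangle of `G[S]` as neighbours (so it is inserted into a face of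
`G[S]`), and the number of inserted vertices equals the number `2|S| - 4` of faces
of `G[S]` (so that exactly one vertex is inserted into each face). -/
def IsKleetopeOf {V : Type} [Fintype V] [DecidableEq V]
    (G : SimpleGraph V) (S : Finset V) : Prop :=
  IsTriangulation G ∧ IsTriangulation (G.induce (S : Set V)) ∧
    (∀ v : V, v ∉ S →
      (G.neighborSet v).ncard = 3 ∧ G.neighborSet v ⊆ (S : Set V) ∧
        ∀ a ∈ G.neighborSet v, ∀ b ∈ G.neighborSet v, a ≠ b → G.Adj a b) ∧
    Fintype.card V + 4 = 3 * S.card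

end

/-- The chords with ends `a, b` and `c, d` on a line cross. -/
def ChordsCross (a b c d : ℝ) : Prop :=
  (((a < c ∧ c < b) ∨ (b < c ∧ c < a)) ∧ ((d < a ∧ d < b) ∨ (a < d ∧ b < d))) ∨
  (((a < d ∧ d < b) ∨ (b < d ∧ d < a)) ∧ ((c < a ∧ c < b) ∨ (a < c ∧ b < c)))

theorem ChordsCross.symm {a b c d : ℝ} (h : ChordsCross a b c d) : ChordsCross c d a b := by
  unfold ChordsCross at *
  grind

theorem not_chordsCross_of_eq {a b c d : ℝ} (h : a = c ∨ a = d ∨ b = c ∨ b = d) :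
    ¬ ChordsCross a b c d := by
  unfold ChordsCross
  grind

theorem not_chordsCross_congr {V : Type} {pos : V → ℝ} {a b c d : V} {x y : ℝ}
    (e : s(a, b) = s(c, d)) (h : ¬ ChordsCross x y (pos c) (pos d)) :
    ¬ ChordsCross x y (pos a) (pos b) := by
  rcases Sym2.eq_iff.1 e with ⟨rfl, rfl⟩ | ⟨rfl, rfl⟩
  · exact h
  · unfold ChordsCross at *
    grind

theorem chordsCross_of_interleaved {a b c d : ℝ}
    (h : Interleaved (min a b, max a b) (min c d, max c d)) : ChordsCross a b c d := by
  unfold Interleaved at h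
  unfold ChordsCross
  grind

/-- A place reserved for the vertex inserted into the face `{left, right, apex}`: the gap between
`left` and `right` on the spine, and the page on which the new vertex sees `apex`. -/
structure InsertionSlot (V : Type) where
  left : V
  right : V
  apex : V
  page : Bool

namespace InsertionSlot

variable {V : Type}

/-- No vertex of `W` is placed strictly between `a` and `b`. -/
def Consecutive (pos : V → ℝ) (W : Set V) (a b : V) : Prop :=
  ∀ x ∈ W, ¬ (pos a < pos x ∧ pos x < pos b)

/-- The slot `s` can be used to insert a vertex into the face `f` of `G[W]`. -/
structure Fits [DecidableEq V] (G : SimpleGraph V) (W : Set V) (pos : V → ℝ) (page : Sym2 V → Bool)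
    (s : InsertionSlot V) (f : Finset V) : Prop where
  face_eq : f = {s.left, s.right, s.apex}
  left_mem : s.left ∈ W
  right_mem : s.right ∈ W
  apex_mem : s.apex ∈ W
  lt : pos s.left < pos s.right
  apex_ne_left : s.apex ≠ s.left
  apex_ne_right : s.apex ≠ s.right
  consecutive : Consecutive pos W s.left s.right
  visible : ∀ g, pos s.left < g → g < pos s.right → ∀ a ∈ W, ∀ b ∈ W, G.Adj a b →
    page s(a, b) = s.page → s(a, b) ≠ s(s.left, s.right) →
    ¬ ChordsCross g (pos s.apex) (pos a) (pos b)

/-- The slots `s` and `t` can be used independently of each other. -/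
def Compatible (pos : V → ℝ) (s t : InsertionSlot V) : Prop :=
  s.left ≠ t.left ∧ (s.page = t.page → ∀ g h, pos s.left < g → g < pos s.right →
    pos t.left < h → h < pos t.right → ¬ ChordsCross g (pos s.apex) h (pos t.apex))

theorem Compatible.symm {pos : V → ℝ} {s t : InsertionSlot V} (h : Compatible pos s t) :
    Compatible pos t s :=
  ⟨h.1.symm, fun hp g g' h1 h2 h3 h4 hc => h.2 hp.symm g' g h3 h4 h1 h2 hc.symm⟩

end InsertionSlot

open InsertionSlot

/-- A two-page layout of `G[W]` with pairwise compatible insertion slots for the faces in `A`. -/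
structure TwoPageLayout {V : Type} [DecidableEq V] (G : SimpleGraph V) (W : Set V)
    (A : Set (Finset V)) (pos : V → ℝ) (page : Sym2 V → Bool)
    (slot : Finset V → InsertionSlot V) : Prop where
  injOn : Set.InjOn pos W
  plane : ∀ a ∈ W, ∀ b ∈ W, ∀ c ∈ W, ∀ d ∈ W, G.Adj a b → G.Adj c d →
    page s(a, b) = page s(c, d) → ¬ ChordsCross (pos a) (pos b) (pos c) (pos d)
  fits : ∀ f ∈ A, (slot f).Fits G W pos page f
  compatible : ∀ f ∈ A, ∀ f' ∈ A, f ≠ f' → Compatible pos (slot f) (slot f')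

section Layout

variable {V : Type} {G : SimpleGraph V} {W : Set V} {A : Set (Finset V)}
  {pos : V → ℝ} {page : Sym2 V → Bool} {slot : Finset V → InsertionSlot V}

theorem not_chordsCross_of_consecutive {a b c d : V} (h : Consecutive pos W a b)
    (hab : pos a < pos b) (hc : c ∈ W) (hd : d ∈ W) :
    ¬ ChordsCross (pos a) (pos b) (pos c) (pos d) := by
  have h1 := h c hc
  have h2 := h d hd
  unfold ChordsCross
  grind

/-- An edge between consecutive vertices does not obstruct any slot other than its own. -/
theorem not_chordsCross_gap_of_consecutive (hinj : Set.InjOn pos W) {a b l r t : V} {g : ℝ}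
    (ha : a ∈ W) (hb : b ∈ W) (hl : l ∈ W) (hr : r ∈ W) (ht : t ∈ W)
    (hab : Consecutive pos W a b) (hlt : pos a < pos b) (hlr : Consecutive pos W l r)
    (h1 : pos l < g) (h2 : g < pos r) (hne : a ≠ l) :
    ¬ ChordsCross g (pos t) (pos a) (pos b) := by
  have h3 := hab l hl
  have h4 := hab r hr
  have h5 := hab t ht
  have h6 := hlr a ha
  have h7 := hlr b hb
  have h8 : pos a ≠ pos l := fun h => hne (hinj ha hl h)
  unfold ChordsCross
  grind

theorem right_eq_of_consecutive (hinj : Set.InjOn pos W) {a b b' : V} (hb : b ∈ W) (hb' : b' ∈ W)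
    (hlt : pos a < pos b) (hlt' : pos a < pos b')
    (h : Consecutive pos W a b) (h' : Consecutive pos W a b') : b = b' := by
  have h1 := h b' hb'
  have h2 := h' b hb
  apply hinj hb hb'
  grind

variable [DecidableEq V]

theorem TwoPageLayout.mono {A' : Set (Finset V)} (h : TwoPageLayout G W A pos page slot)
    (hA : A' ⊆ A) : TwoPageLayout G W A' pos page slot :=
  ⟨h.injOn, h.plane, fun f hf => h.fits f (hA hf),
    fun f hf f' hf' => h.compatible f (hA hf) f' (hA hf')⟩

/-- A layout of `G[W]` does not depend on the position of a vertex outside `W`, nor on the pages of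
its edges. -/
theorem TwoPageLayout.congr_off (h : TwoPageLayout G W A pos page slot) {z : V} (hz : z ∉ W)
    (x : ℝ) (w : V) (p : Bool) :
    TwoPageLayout G W A (Function.update pos z x) (Function.update page s(z, w) p) slot := by
  have hpos : ∀ y ∈ W, Function.update pos z x y = pos y := fun y hy =>
    Function.update_of_ne (fun e : y = z => hz (e ▸ hy)) _ _
  have hpage : ∀ a ∈ W, ∀ b ∈ W, Function.update page s(z, w) p s(a, b) = page s(a, b) := by
    intro a ha b hb
    apply Function.update_of_ne
    intro e
    have : z ∈ s(a, b) := by rw [e]; exact Sym2.mem_mk_left z w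
    rcases Sym2.mem_iff.1 this with rfl | rfl <;> contradiction
  refine ⟨fun a ha b hb e => h.injOn ha hb (by rwa [hpos a ha, hpos b hb] at e), ?_, ?_, ?_⟩
  · intro a ha b hb c hc d hd
    rw [hpos a ha, hpos b hb, hpos c hc, hpos d hd, hpage a ha b hb, hpage c hc d hd]
    exact h.plane a ha b hb c hc d hd
  · intro f hf
    have H := h.fits f hf
    have hl := hpos _ H.left_mem
    have hr := hpos _ H.right_mem
    have ht := hpos _ H.apex_mem
    refine ⟨H.face_eq, H.left_mem, H.right_mem, H.apex_mem, by rw [hl, hr]; exact H.lt,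
      H.apex_ne_left, H.apex_ne_right, ?_, ?_⟩
    · intro y hy
      rw [hl, hr, hpos y hy]
      exact H.consecutive y hy
    · intro g h1 h2 a ha b hb
      rw [hl] at h1
      rw [hr] at h2
      rw [ht, hpos a ha, hpos b hb, hpage a ha b hb]
      exact H.visible g h1 h2 a ha b hb
  · intro f hf f' hf' hne
    have H := h.fits f hf
    have H' := h.fits f' hf'
    have K := h.compatible f hf f' hf' hne
    unfold Compatible at K ⊢
    rwa [hpos _ H.left_mem, hpos _ H.right_mem, hpos _ H.apex_mem, hpos _ H'.left_mem,
      hpos _ H'.right_mem, hpos _ H'.apex_mem]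

/-- An edge between two consecutive vertices can be moved to either page. -/
theorem TwoPageLayout.setPage (h : TwoPageLayout G W A pos page slot) {u v : V} (hu : u ∈ W)
    (hv : v ∈ W) (hlt : pos u < pos v) (huv : Consecutive pos W u v) (p : Bool) :
    TwoPageLayout G W A pos (Function.update page s(u, v) p) slot := by
  have key : ∀ a ∈ W, ∀ b ∈ W, ∀ c ∈ W, ∀ d ∈ W, s(a, b) = s(u, v) →
      ¬ ChordsCross (pos a) (pos b) (pos c) (pos d) := by
    intro a ha b hb c hc d hd e
    have := not_chordsCross_of_consecutive huv hlt hc hd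
    exact fun hx => not_chordsCross_congr e (fun hy => this hy.symm) hx.symm
  refine ⟨h.injOn, ?_, ?_, h.compatible⟩
  · intro a ha b hb c hc d hd hab hcd hp
    by_cases e : s(a, b) = s(u, v)
    · exact key a ha b hb c hc d hd e
    by_cases e' : s(c, d) = s(u, v)
    · exact fun hx => key c hc d hd a ha b hb e' hx.symm
    rw [Function.update_of_ne e, Function.update_of_ne e'] at hp
    exact h.plane a ha b hb c hc d hd hab hcd hp
  · intro f hf
    have H := h.fits f hf
    refine ⟨H.face_eq, H.left_mem, H.right_mem, H.apex_mem, H.lt, H.apex_ne_left,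
      H.apex_ne_right, H.consecutive, ?_⟩
    intro g h1 h2 a ha b hb hab hp hne
    by_cases e : s(a, b) = s(u, v)
    · have hul : u ≠ (slot f).left := by
        intro hul
        apply hne
        rw [e, hul, right_eq_of_consecutive h.injOn hv H.right_mem (hul ▸ hlt) H.lt
          (hul ▸ huv) H.consecutive]
      have := not_chordsCross_gap_of_consecutive h.injOn hu hv H.left_mem H.right_mem
        H.apex_mem huv hlt H.consecutive h1 h2 hul
      exact not_chordsCross_congr e this
    · rw [Function.update_of_ne e] at hp
      exact H.visible g h1 h2 a ha b hb hab hp hne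

/-- Insert the vertex `z` into the face `f₀` at its slot.  The two new gaps beside `z` serve two of
the three faces created by the insertion. -/
theorem TwoPageLayout.insert_vertex (h : TwoPageLayout G W A pos page slot) {f₀ : Finset V} (hf₀ : f₀ ∈ A)
    {z u v w : V} {p : Bool} (hs : slot f₀ = ⟨u, v, w, p⟩) (hz : z ∉ W)
    (hadj : ∀ x ∈ W, G.Adj z x → x ∈ f₀) (huz : pos u < pos z) (hzv : pos z < pos v)
    (hpzw : page s(z, w) = p) (hpuv : page s(u, v) = !p) {tl tr : V} {pl pr : Bool}
    (hl : tl = w ∧ pl = p ∨ tl = v ∧ pl = !p) (hr : tr = w ∧ pr = p ∨ tr = u ∧ pr = !p)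
    (hlr : pl = pr → tl = w ∧ tr = w) :
    TwoPageLayout G (insert z W) (A \ {f₀} ∪ {{u, z, tl}, {z, v, tr}}) pos page
      (fun f => if f = {u, z, tl} then ⟨u, z, tl, pl⟩
        else if f = {z, v, tr} then ⟨z, v, tr, pr⟩ else slot f) := by
  have H := h.fits f₀ hf₀
  rw [hs] at H
  obtain ⟨hface, hu, hv, hw, huv, hwu, hwv, hcons, hvis⟩ := H
  dsimp only at hface hu hv hw huv hwu hwv hcons hvis
  have hzu' : z ≠ u := fun e => hz (e ▸ hu)
  have hout : ∀ x ∈ W, pos x ≤ pos u ∨ pos v ≤ pos x := by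
    intro x hx
    have := hcons x hx
    grind
  have hinj : Set.InjOn pos (insert z W) := by
    rw [Set.injOn_insert hz]
    refine ⟨h.injOn, ?_⟩
    rintro ⟨x, hx, e⟩
    have := hout x hx
    grind
  have hcl : Consecutive pos (insert z W) u z := by
    rintro x (rfl | hx)
    · grind
    · have := hout x hx
      grind
  have hcr : Consecutive pos (insert z W) z v := by
    rintro x (rfl | hx)
    · grind
    · have := hout x hx
      grind
  have hWz : ∀ x ∈ W, x ∈ insert z W := fun x hx => Set.mem_insert_of_mem z hx
  have hz_mem : z ∈ insert z W := Set.mem_insert z W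
  have hnbr : ∀ x ∈ W, G.Adj z x → x = u ∨ x = v ∨ x = w := by
    intro x hx hzx
    have := hadj x hx hzx
    rw [hface] at this
    simpa using this
  have hedge : ∀ a ∈ insert z W, ∀ b ∈ insert z W, G.Adj a b →
      (a ∈ W ∧ b ∈ W ∧ s(a, b) ≠ s(u, v)) ∨ s(a, b) = s(u, v) ∨ s(a, b) = s(u, z) ∨
        s(a, b) = s(z, v) ∨ s(a, b) = s(z, w) := by
    rintro a (rfl | ha) b (rfl | hb) hab
    · exact absurd rfl hab.ne
    · rcases hnbr b hb hab with rfl | rfl | rfl <;> simp [Sym2.eq_swap]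
    · rcases hnbr a ha hab.symm with rfl | rfl | rfl <;> simp [Sym2.eq_swap]
    · by_cases e : s(a, b) = s(u, v)
      · exact Or.inr (Or.inl e)
      · exact Or.inl ⟨ha, hb, e⟩
  have hcompat : ∀ f ∈ A \ {f₀}, Compatible pos (slot f) ⟨u, v, w, p⟩ := by
    rintro f ⟨hf, hne⟩
    exact hs ▸ h.compatible f hf f₀ hf₀ hne
  have hgap : ∀ f ∈ A \ {f₀}, ∀ g, pos (slot f).left < g → g < pos (slot f).right →
      g < pos u ∨ pos v < g := by
    intro f hf g h1 h2
    have H := h.fits f hf.1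
    have h3 := H.consecutive u hu
    have h4 := H.consecutive v hv
    have h5 : pos (slot f).left ≠ pos u := fun e => (hcompat f hf).1 (h.injOn H.left_mem hu e)
    have h6 := hout _ H.left_mem
    have h7 := hout _ H.right_mem
    grind
  have hold : ∀ f ∈ A \ {f₀}, (slot f).Fits G (insert z W) pos page f := by
    intro f hf
    have H := h.fits f hf.1
    have K := hcompat f hf
    have hc : Consecutive pos (insert z W) (slot f).left (slot f).right := by
      rintro x (rfl | hx) ⟨h1, h2⟩
      · have := hgap f hf _ h1 h2
        grind
      · exact H.consecutive x hx ⟨h1, h2⟩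
    refine ⟨H.face_eq, hWz _ H.left_mem, hWz _ H.right_mem, hWz _ H.apex_mem, H.lt,
      H.apex_ne_left, H.apex_ne_right, hc, ?_⟩
    intro g h1 h2 a ha b hb hab hp hne
    rcases hedge a ha b hb hab with ⟨ha, hb, -⟩ | e | e | e | e
    · exact H.visible g h1 h2 a ha b hb hab hp hne
    · exact not_chordsCross_congr e (not_chordsCross_gap_of_consecutive h.injOn hu hv H.left_mem
        H.right_mem H.apex_mem hcons huv H.consecutive h1 h2 K.1.symm)
    · exact not_chordsCross_congr e (not_chordsCross_gap_of_consecutive hinj (hWz _ hu) hz_mem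
        (hWz _ H.left_mem) (hWz _ H.right_mem) (hWz _ H.apex_mem) hcl huz hc h1 h2 K.1.symm)
    · exact not_chordsCross_congr e (not_chordsCross_gap_of_consecutive hinj hz_mem (hWz _ hv)
        (hWz _ H.left_mem) (hWz _ H.right_mem) (hWz _ H.apex_mem) hcr hzv hc h1 h2
        (fun e => hz (e ▸ H.left_mem)))
    · rw [e, hpzw] at hp
      exact not_chordsCross_congr e (K.2 hp.symm g (pos z) h1 h2 huz hzv)
  have hfl : Fits G (insert z W) pos page ⟨u, z, tl, pl⟩ {u, z, tl} := by
    have htl : tl ∈ W ∧ tl ≠ u := by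
      rcases hl with ⟨rfl, -⟩ | ⟨rfl, -⟩
      · exact ⟨hw, hwu⟩
      · exact ⟨hv, fun e => by rw [e] at huv; exact lt_irrefl _ huv⟩
    refine ⟨rfl, hWz _ hu, hz_mem, hWz _ htl.1, huz, htl.2, fun e : tl = z => hz (e ▸ htl.1), hcl, ?_⟩
    dsimp only
    intro g h1 h2 a ha b hb hab hp hne
    rcases hedge a ha b hb hab with ⟨ha, hb, hne'⟩ | e | e | e | e
    · rcases hl with ⟨rfl, rfl⟩ | ⟨rfl, rfl⟩
      · exact hvis g h1 (h2.trans hzv) a ha b hb hab hp hne'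
      · have := hout a ha
        have := hout b hb
        unfold ChordsCross
        grind
    · refine not_chordsCross_congr e ?_
      rcases hl with ⟨rfl, rfl⟩ | ⟨rfl, rfl⟩
      · rw [e, hpuv] at hp
        simp at hp
      · exact not_chordsCross_of_eq (by simp)
    · exact absurd e hne
    · exact not_chordsCross_congr e (not_chordsCross_gap_of_consecutive hinj hz_mem (hWz _ hv)
        (hWz _ hu) hz_mem (hWz _ htl.1) hcr hzv hcl h1 h2 hzu')
    · refine not_chordsCross_congr e ?_
      rcases hl with ⟨rfl, rfl⟩ | ⟨rfl, rfl⟩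
      · exact not_chordsCross_of_eq (by simp)
      · rw [e, hpzw] at hp
        simp at hp
  have hfr : Fits G (insert z W) pos page ⟨z, v, tr, pr⟩ {z, v, tr} := by
    have htr : tr ∈ W ∧ tr ≠ v := by
      rcases hr with ⟨rfl, -⟩ | ⟨rfl, -⟩
      · exact ⟨hw, hwv⟩
      · exact ⟨hu, fun e => by rw [e] at huv; exact lt_irrefl _ huv⟩
    refine ⟨rfl, hz_mem, hWz _ hv, hWz _ htr.1, hzv, fun e : tr = z => hz (e ▸ htr.1), htr.2, hcr, ?_⟩
    dsimp only
    intro g h1 h2 a ha b hb hab hp hne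
    rcases hedge a ha b hb hab with ⟨ha, hb, hne'⟩ | e | e | e | e
    · rcases hr with ⟨rfl, rfl⟩ | ⟨rfl, rfl⟩
      · exact hvis g (huz.trans h1) h2 a ha b hb hab hp hne'
      · have := hout a ha
        have := hout b hb
        unfold ChordsCross
        grind
    · refine not_chordsCross_congr e ?_
      rcases hr with ⟨rfl, rfl⟩ | ⟨rfl, rfl⟩
      · rw [e, hpuv] at hp
        simp at hp
      · exact not_chordsCross_of_eq (by simp)
    · exact not_chordsCross_congr e (not_chordsCross_gap_of_consecutive hinj (hWz _ hu) hz_mem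
        hz_mem (hWz _ hv) (hWz _ htr.1) hcl huz hcr h1 h2 hzu'.symm)
    · exact absurd e hne
    · refine not_chordsCross_congr e ?_
      rcases hr with ⟨rfl, rfl⟩ | ⟨rfl, rfl⟩
      · exact not_chordsCross_of_eq (by simp)
      · rw [e, hpzw] at hp
        simp at hp
  have hcompl : ∀ f ∈ A \ {f₀}, Compatible pos (slot f) ⟨u, z, tl, pl⟩ := by
    intro f hf
    have K := hcompat f hf
    refine ⟨K.1, ?_⟩
    dsimp only
    intro hp g g' h1 h2 h3 h4
    rcases hl with ⟨rfl, rfl⟩ | ⟨rfl, rfl⟩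
    · exact K.2 hp g g' h1 h2 h3 (h4.trans hzv)
    · have h5 := hgap f hf g h1 h2
      have h6 := hout _ (h.fits f hf.1).apex_mem
      unfold ChordsCross
      grind
  have hcompr : ∀ f ∈ A \ {f₀}, Compatible pos (slot f) ⟨z, v, tr, pr⟩ := by
    intro f hf
    have K := hcompat f hf
    refine ⟨fun e : (slot f).left = z => hz (e ▸ (h.fits f hf.1).left_mem), ?_⟩
    dsimp only
    intro hp g g' h1 h2 h3 h4
    rcases hr with ⟨rfl, rfl⟩ | ⟨rfl, rfl⟩
    · exact K.2 hp g g' h1 h2 (huz.trans h3) h4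
    · have h5 := hgap f hf g h1 h2
      have h6 := hout _ (h.fits f hf.1).apex_mem
      unfold ChordsCross
      grind
  have hcomplr : Compatible pos ⟨u, z, tl, pl⟩ ⟨z, v, tr, pr⟩ := by
    refine ⟨hzu'.symm, fun hp g g' _ _ _ _ => not_chordsCross_of_eq ?_⟩
    obtain ⟨rfl, rfl⟩ := hlr hp
    simp
  have hshort : ∀ a b c d, c ∈ insert z W → d ∈ insert z W →
      s(a, b) = s(u, z) ∨ s(a, b) = s(z, v) → ¬ ChordsCross (pos a) (pos b) (pos c) (pos d) := by
    rintro a b c d hc hd (e | e) hx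
    · exact not_chordsCross_congr e
        (fun hy => not_chordsCross_of_consecutive hcl huz hc hd hy.symm) hx.symm
    · exact not_chordsCross_congr e
        (fun hy => not_chordsCross_of_consecutive hcr hzv hc hd hy.symm) hx.symm
  refine ⟨hinj, ?_, ?_, ?_⟩
  · intro a ha b hb c hc d hd hab hcd hp
    by_cases e : s(a, b) = s(u, z) ∨ s(a, b) = s(z, v)
    · exact hshort a b c d hc hd e
    by_cases e' : s(c, d) = s(u, z) ∨ s(c, d) = s(z, v)
    · exact fun hx => hshort c d a b ha hb e' hx.symm
    rcases hedge a ha b hb hab with ⟨ha, hb, hne⟩ | e1 | e1 | e1 | e1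
    · rcases hedge c hc d hd hcd with ⟨hc, hd, hne'⟩ | e2 | e2 | e2 | e2
      · exact h.plane a ha b hb c hc d hd hab hcd hp
      · refine not_chordsCross_congr e2 fun hx => ?_
        exact not_chordsCross_of_consecutive hcons huv ha hb hx.symm
      · exact absurd (Or.inl e2) e'
      · exact absurd (Or.inr e2) e'
      · refine not_chordsCross_congr e2 fun hx => ?_
        rw [e2, hpzw] at hp
        exact hvis (pos z) huz hzv a ha b hb hab hp hne hx.symm
    · rcases hedge c hc d hd hcd with ⟨hc, hd, hne'⟩ | e2 | e2 | e2 | e2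
      · refine fun hx => not_chordsCross_congr e1 (fun hy => ?_) hx.symm
        exact not_chordsCross_of_consecutive hcons huv hc hd hy.symm
      · rw [← e2] at e1
        exact not_chordsCross_congr e1.symm (not_chordsCross_of_eq (by simp))
      · exact absurd (Or.inl e2) e'
      · exact absurd (Or.inr e2) e'
      · rw [e1, e2, hpzw, hpuv] at hp
        simp at hp
    · exact absurd (Or.inl e1) e
    · exact absurd (Or.inr e1) e
    · rcases hedge c hc d hd hcd with ⟨hc, hd, hne'⟩ | e2 | e2 | e2 | e2
      · refine fun hx => not_chordsCross_congr e1 (fun hy => ?_) hx.symm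
        rw [e1, hpzw] at hp
        exact hvis (pos z) huz hzv c hc d hd hcd hp.symm hne' hy.symm
      · rw [e1, e2, hpzw, hpuv] at hp
        simp at hp
      · exact absurd (Or.inl e2) e'
      · exact absurd (Or.inr e2) e'
      · rw [← e2] at e1
        exact not_chordsCross_congr e1.symm (not_chordsCross_of_eq (by simp))
  · intro f hf
    split_ifs with e e'
    · exact e ▸ hfl
    · exact e' ▸ hfr
    · exact hold f (by simpa [e, e'] using hf)
  · intro f hf f' hf' hne
    split_ifs with e1 e2 e3 e4 e5 e6
    · exact absurd (e1.trans e2.symm) hne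
    · exact hcomplr
    · exact (hcompl f' (by simpa [e2, e3] using hf')).symm
    · exact hcomplr.symm
    · exact absurd (e4.trans e6.symm) hne
    · exact (hcompr f' (by simpa [e5, e6] using hf')).symm
    · exact hcompl f (by simpa [e1, e4] using hf)
    · exact hcompr f (by simpa [e1, e4] using hf)
    · exact h.compatible f (by simp [e1, e4] at hf; exact hf.1) f' (by simp_all) hne

/-- A vertex can be inserted into any face that has a slot so that all but one of the new faces get
a slot. -/
theorem TwoPageLayout.exists_insert (h : TwoPageLayout G W A pos page slot) {f₀ : Finset V}
    (hf₀ : f₀ ∈ A) {z x₀ : V} (hz : z ∉ W) (hadj : ∀ x ∈ W, G.Adj z x → x ∈ f₀) (hx₀ : x₀ ∈ f₀) :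
    ∃ pos page slot, TwoPageLayout G (insert z W)
      (A \ {f₀} ∪ {g | ∃ x ∈ f₀, x ≠ x₀ ∧ g = insert z (f₀.erase x)}) pos page slot := by
  have H := h.fits f₀ hf₀
  rcases hs : slot f₀ with ⟨u, v, w, p⟩
  rw [hs] at H
  obtain ⟨hface, hu, hv, hw, huv, hwu, hwv, hcons, -⟩ := H
  dsimp only at hface hu hv hw huv hwu hwv hcons
  have hvu : v ≠ u := fun e => lt_irrefl _ (e ▸ huv)
  have hzu : u ≠ z := fun e => hz (e ▸ hu)
  have hzv : v ≠ z := fun e => hz (e ▸ hv)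
  have K := (h.setPage hu hv huv hcons (!p)).congr_off hz ((pos u + pos v) / 2) w p
  have h1 : Function.update pos z ((pos u + pos v) / 2) u <
      Function.update pos z ((pos u + pos v) / 2) z := by
    rw [Function.update_self, Function.update_of_ne hzu]
    linarith
  have h2 : Function.update pos z ((pos u + pos v) / 2) z <
      Function.update pos z ((pos u + pos v) / 2) v := by
    rw [Function.update_self, Function.update_of_ne hzv]
    linarith
  have hne : s(u, v) ≠ s(z, w) := by
    intro e
    rcases Sym2.eq_iff.1 e with ⟨e, -⟩ | ⟨-, e⟩
    · exact hzu e
    · exact hzv e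
  have h3 : Function.update (Function.update page s(u, v) (!p)) s(z, w) p s(z, w) = p :=
    Function.update_self ..
  have h4 : Function.update (Function.update page s(u, v) (!p)) s(z, w) p s(u, v) = !p := by
    rw [Function.update_of_ne hne, Function.update_self]
  have eu : insert z (f₀.erase u) = {z, v, w} := by grind
  have ev : insert z (f₀.erase v) = {u, z, w} := by grind
  have ewl : insert z (f₀.erase w) = {u, z, v} := by grind
  have ewr : insert z (f₀.erase w) = {z, v, u} := by grind
  have hx₀' : x₀ = u ∨ x₀ = v ∨ x₀ = w := by simpa [hface] using hx₀
  have hcases : ∀ x ∈ f₀, x = u ∨ x = v ∨ x = w := by simp [hface]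
  rcases hx₀' with rfl | rfl | rfl
  · refine ⟨_, _, _, (K.insert_vertex hf₀ hs hz hadj h1 h2 h3 h4 (Or.inl ⟨rfl, rfl⟩)
      (Or.inr ⟨rfl, rfl⟩) (by simp)).mono (Set.union_subset_union_right _ ?_)⟩
    rintro g ⟨x, hx, hne, rfl⟩
    rcases hcases x hx with rfl | rfl | rfl
    · exact absurd rfl hne
    · exact Or.inl ev
    · exact Or.inr ewr
  · refine ⟨_, _, _, (K.insert_vertex hf₀ hs hz hadj h1 h2 h3 h4 (Or.inr ⟨rfl, rfl⟩)
      (Or.inl ⟨rfl, rfl⟩) (by simp)).mono (Set.union_subset_union_right _ ?_)⟩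
    rintro g ⟨x, hx, hne, rfl⟩
    rcases hcases x hx with rfl | rfl | rfl
    · exact Or.inr eu
    · exact absurd rfl hne
    · exact Or.inl ewl
  · refine ⟨_, _, _, (K.insert_vertex hf₀ hs hz hadj h1 h2 h3 h4 (Or.inl ⟨rfl, rfl⟩)
      (Or.inl ⟨rfl, rfl⟩) (by simp)).mono (Set.union_subset_union_right _ ?_)⟩
    rintro g ⟨x, hx, hne, rfl⟩
    rcases hcases x hx with rfl | rfl | rfl
    · exact Or.inr eu
    · exact Or.inl ev
    · exact absurd rfl hne

/-- Three vertices on the spine, with the slot between the first two. -/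
theorem twoPageLayout_triangle {a b c : V} (hab : pos a < pos b) (hbc : pos b < pos c) :
    TwoPageLayout G {a, b, c} {{a, b, c}} pos (fun _ => true) (fun _ => ⟨a, b, c, true⟩) := by
  have hac := hab.trans hbc
  refine ⟨?_, ?_, ?_, ?_⟩
  · rintro x (rfl | rfl | rfl) y (rfl | rfl | rfl) e <;> first | rfl | (exfalso; grind)
  · have key : ∀ x y s t : V, x ∈ ({a, b, c} : Set V) → y ∈ ({a, b, c} : Set V) →
        s ∈ ({a, b, c} : Set V) → t ∈ ({a, b, c} : Set V) →
        ¬ ChordsCross (pos x) (pos y) (pos s) (pos t) := by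
      rintro x y s t (rfl | rfl | rfl) (rfl | rfl | rfl) (rfl | rfl | rfl) (rfl | rfl | rfl) <;>
        unfold ChordsCross <;> grind
    intro x hx y hy s hs t ht _ _ _
    exact key x y s t hx hy hs ht
  · rintro f rfl
    refine ⟨rfl, by simp, by simp, by simp, hab, ?_, ?_, ?_, ?_⟩
    · exact fun e : c = a => by rw [e] at hac; exact lt_irrefl _ hac
    · exact fun e : c = b => by rw [e] at hbc; exact lt_irrefl _ hbc
    · rintro x (rfl | rfl | rfl) <;> dsimp only <;> grind
    · dsimp only
      rintro g h1 h2 x (rfl | rfl | rfl) y (rfl | rfl | rfl) hxy - hne <;>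
        first
        | exact absurd rfl hxy.ne
        | exact absurd rfl hne
        | exact absurd Sym2.eq_swap hne
        | exact not_chordsCross_of_eq (by simp)
  · rintro f rfl f' rfl hne
    exact absurd rfl hne

end Layout

namespace P3TConstruction

variable {V : Type} [Fintype V] [DecidableEq V] {G : SimpleGraph V}

/-- The first `i` vertices of the construction sequence. -/
def firstVertices (C : P3TConstruction V G) (i : ℕ) : Set V :=
  {x | (C.ord.symm x : ℕ) < i}

/-- The faces present after `i` steps that are still to be subdivided. -/
def activeFaces (C : P3TConstruction V G) (i : ℕ) : Set (Finset V) :=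
  {f | ∃ j : Fin C.n, 3 ≤ (j : ℕ) ∧ i ≤ (j : ℕ) ∧ C.F j = f ∧ ∀ x ∈ f, x ∈ C.firstVertices i}

variable (C : P3TConstruction V G)

theorem ord_mem_firstVertices {j : Fin C.n} {i : ℕ} :
    C.ord j ∈ C.firstVertices i ↔ (j : ℕ) < i := by
  simp [firstVertices]

theorem firstVertices_succ (j : Fin C.n) :
    C.firstVertices (j + 1) = insert (C.ord j) (C.firstVertices j) := by
  ext x
  obtain ⟨k, rfl⟩ := C.ord.surjective x
  rw [Set.mem_insert_iff, ord_mem_firstVertices, ord_mem_firstVertices, C.ord.injective.eq_iff,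
    Fin.ext_iff]
  omega

theorem mem_firstVertices_of_mem_F {j : Fin C.n} (hj : 3 ≤ (j : ℕ)) {x : V} (hx : x ∈ C.F j) :
    x ∈ C.firstVertices j := by
  obtain ⟨i, hi, rfl⟩ := C.F_sub j hj x hx
  exact C.ord_mem_firstVertices.2 hi

theorem F_mem_activeFaces {j : Fin C.n} (hj : 3 ≤ (j : ℕ)) : C.F j ∈ C.activeFaces j :=
  ⟨j, hj, le_rfl, rfl, fun _ hx => C.mem_firstVertices_of_mem_F hj hx⟩

theorem isFace_F {j : Fin C.n} (hj : 3 ≤ (j : ℕ)) : C.IsFace (C.F j) := by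
  rcases C.F_created j hj with h | ⟨i, -, hi, x, hx, h⟩
  · exact Or.inl h
  · exact Or.inr ⟨C.F i, i, hi, rfl, x, hx, h⟩

theorem coe_rootFace : (C.rootFace : Set V) = C.firstVertices 3 := by
  ext x
  obtain ⟨k, rfl⟩ := C.ord.surjective x
  rw [ord_mem_firstVertices]
  simp only [rootFace, Finset.coe_insert, Finset.coe_singleton, Set.mem_insert_iff,
    Set.mem_singleton_iff, C.ord.injective.eq_iff, Fin.ext_iff]
  omega

theorem childFace_injOn {j : Fin C.n} (hj : 3 ≤ (j : ℕ)) :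
    Set.InjOn (C.childFace j) (C.F j : Set V) := by
  have hn : C.ord j ∉ C.F j := fun h =>
    lt_irrefl _ (C.ord_mem_firstVertices.1 (C.mem_firstVertices_of_mem_F hj h))
  intro x hx y hy h
  by_contra hne
  have h1 : x ∈ C.childFace j y :=
    Finset.mem_insert_of_mem (Finset.mem_erase.2 ⟨hne, hx⟩)
  rw [← h, childFace, Finset.mem_insert] at h1
  rcases h1 with h1 | h1
  · exact hn (h1 ▸ hx)
  · exact Finset.notMem_erase x _ h1

/-- A face of grand-degree at most two has a child that is never subdivided. -/
theorem exists_childFace_not_internal {j : Fin C.n} (hj : 3 ≤ (j : ℕ)) (hgd : C.gd (C.F j) ≤ 2) :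
    ∃ x ∈ C.F j, ¬ C.IsInternalFace (C.childFace j x) := by
  by_contra! hall
  have hsub : C.childFace j '' (C.F j : Set V) ⊆
      {g | C.IsChildOf g (C.F j) ∧ C.IsInternalFace g} := by
    rintro _ ⟨x, hx, rfl⟩
    exact ⟨⟨j, hj, rfl, x, hx, rfl⟩, hall x hx⟩
  have hle := Set.ncard_le_ncard hsub (Set.toFinite _)
  rw [(C.childFace_injOn hj).ncard_image, Set.ncard_coe_finset, C.F_card j hj] at hle
  unfold gd at hgd
  omega

theorem activeFaces_three_subset : C.activeFaces 3 ⊆ {C.rootFace} := by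
  rintro f ⟨j, hj, -, rfl, hf⟩
  have hsub : C.F j ⊆ C.rootFace := by
    intro x hx
    have := hf x hx
    rwa [← coe_rootFace] at this
  refine Finset.eq_of_subset_of_card_le hsub ?_
  rw [C.F_card j hj]
  exact Finset.card_le_three

/-- The active faces after a step are old ones or children of the face subdivided in that step. -/
theorem activeFaces_succ_subset {j : Fin C.n} (hj : 3 ≤ (j : ℕ)) {x₀ : V}
    (hx₀ : ¬ C.IsInternalFace (C.childFace j x₀)) :
    C.activeFaces (j + 1) ⊆ C.activeFaces j \ {C.F j} ∪
      {g | ∃ x ∈ C.F j, x ≠ x₀ ∧ g = insert (C.ord j) ((C.F j).erase x)} := by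
  rintro f ⟨k, hk, hjk, rfl, hf⟩
  by_cases hmem : C.ord j ∈ C.F k
  · right
    rcases C.F_created k hk with h | ⟨i, -, hi, x, hx, h⟩
    · have : C.ord j ∈ C.firstVertices 3 := by
        rw [← coe_rootFace, rootFace, ← h]
        exact hmem
      rw [ord_mem_firstVertices] at this
      omega
    · have hij : (i : ℕ) < j + 1 :=
        C.ord_mem_firstVertices.1 (hf _ (h ▸ Finset.mem_insert_self _ _))
      have hji : j ≤ i := by
        rw [h, Finset.mem_insert] at hmem
        rcases hmem with e | e
        · exact (C.ord.injective e).le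
        · exact (C.ord_mem_firstVertices.1
            (C.mem_firstVertices_of_mem_F hi (Finset.mem_of_mem_erase e))).le
      obtain rfl : i = j := Fin.ext (by have : (j : ℕ) ≤ i := hji; omega)
      exact ⟨x, hx, fun e => hx₀ ⟨k, hk, e ▸ h⟩, h⟩
  · left
    refine ⟨⟨k, hk, by omega, rfl, fun x hx => ?_⟩, fun e => ?_⟩
    · have := hf x hx
      rw [firstVertices_succ] at this
      rcases this with rfl | this
      · exact absurd hx hmem
      · exact this
    · obtain rfl := C.F_inj k j hk hj e
      omega

theorem exists_twoPageLayout (hgd : ∀ f : Finset V, C.IsFace f → C.gd f ≤ 2) (i : ℕ) (hi : 3 ≤ i)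
    (hn : i ≤ C.n) :
    ∃ pos page slot, TwoPageLayout G (C.firstVertices i) (C.activeFaces i) pos page slot := by
  induction i, hi using Nat.le_induction with
  | base =>
    have h := twoPageLayout_triangle (G := G) (pos := fun x => ((C.ord.symm x : ℕ) : ℝ))
      (a := C.ord ⟨0, by omega⟩) (b := C.ord ⟨1, by omega⟩) (c := C.ord ⟨2, by omega⟩)
      (by simp) (by simp)
    have hroot : C.firstVertices 3 =
        {C.ord ⟨0, by omega⟩, C.ord ⟨1, by omega⟩, C.ord ⟨2, by omega⟩} := by
      rw [← coe_rootFace]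
      simp [rootFace]
    rw [hroot]
    exact ⟨_, _, _, h.mono C.activeFaces_three_subset⟩
  | succ i hi ih =>
    obtain ⟨pos, page, slot, h⟩ := ih (by omega)
    let j : Fin C.n := ⟨i, by omega⟩
    have hj : 3 ≤ (j : ℕ) := hi
    obtain ⟨x₀, hx₀, hint⟩ := C.exists_childFace_not_internal hj (hgd _ (C.isFace_F hj))
    have hz : C.ord j ∉ C.firstVertices j := by simp [ord_mem_firstVertices]
    obtain ⟨pos', page', slot', h'⟩ :=
      TwoPageLayout.exists_insert (G := G) (W := C.firstVertices j) (A := C.activeFaces j) h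
        (C.F_mem_activeFaces hj) hz (fun x hx hadj => by
          obtain ⟨k, rfl⟩ := C.ord.surjective x
          exact (C.adj_ins j hj k (C.ord_mem_firstVertices.1 hx)).1 hadj.symm) hx₀
    rw [← C.firstVertices_succ j] at h'
    exact ⟨pos', page', slot', h'.mono (C.activeFaces_succ_subset hj hint)⟩

end P3TConstruction

/-- A two-page layout of the whole graph is a plane arc diagram without biarcs. -/
theorem TwoPageLayout.exists_arcDiagram {V : Type} [DecidableEq V] {G : SimpleGraph V}
    {A : Set (Finset V)} {pos : V → ℝ} {page : Sym2 V → Bool}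
    {slot : Finset V → InsertionSlot V} (h : TwoPageLayout G Set.univ A pos page slot) :
    ∃ D : ArcDiagram V, D.IsPlaneOn G Set.univ ∧
      ∀ e ∈ edgesWithin G Set.univ, D.kind e ≠ ArcKind.biarc := by
  let D : ArcDiagram V :=
    ⟨pos, fun e => if page e then ArcKind.mountain else ArcKind.pocket, fun _ => 0, fun _ => 0⟩
  have hkind : ∀ e, D.kind e ≠ ArcKind.biarc := by
    intro e
    show (if page e then ArcKind.mountain else ArcKind.pocket) ≠ ArcKind.biarc
    split_ifs <;> simp
  have hupper : ∀ e, ∀ q ∈ D.upperArcs e, page e = true ∧ q = (D.lo e, D.hi e) := by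
    intro e q hq
    cases hp : page e <;> simp_all [D, ArcDiagram.upperArcs]
  have hlower : ∀ e, ∀ q ∈ D.lowerArcs e, page e = false ∧ q = (D.lo e, D.hi e) := by
    intro e q hq
    cases hp : page e <;> simp_all [D, ArcDiagram.lowerArcs]
  have hplane : ∀ e ∈ G.edgeSet, ∀ f ∈ G.edgeSet, page e = page f →
      ¬ Interleaved (D.lo e, D.hi e) (D.lo f, D.hi f) := by
    intro e he f hf hp hx
    induction e using Sym2.ind with | _ a b =>
    induction f using Sym2.ind with | _ c d =>
    exact h.plane a trivial b trivial c trivial d trivial he hf hp (chordsCross_of_interleaved hx)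
  refine ⟨D, ⟨h.injOn, fun e _ he => absurd he (hkind e), fun e _ _ _ _ he => absurd he (hkind e),
    fun e he f hf _ => ⟨fun p hp q hq => ?_, fun p hp q hq => ?_⟩⟩, fun e _ => hkind e⟩
  · obtain ⟨h1, rfl⟩ := hupper e p hp
    obtain ⟨h2, rfl⟩ := hupper f q hq
    exact hplane e he.1 f hf.1 (h1.trans h2.symm)
  · obtain ⟨h1, rfl⟩ := hlower e p hp
    obtain ⟨h2, rfl⟩ := hlower f q hq
    exact hplane e he.1 f hf.1 (h1.trans h2.symm)

/-- Let `G` be a planar 3-tree with a construction sequence such that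
every face `f` of its dual face tree satisfies `gd f ≤ 2`.  Then `G` admits a plane
proper arc diagram (a 2-page book embedding): a plane arc diagram in which no edge is
a biarc. -/
theorem gd_le_two_proper_arc_diagram {V : Type} [Fintype V] [DecidableEq V]
    (G : SimpleGraph V) (hpl : IsPlanar G) (C : P3TConstruction V G)
    (hgd : ∀ f : Finset V, C.IsFace f → C.gd f ≤ 2) :
    ∃ A : ArcDiagram V, A.IsPlaneOn G Set.univ ∧
      ∀ e ∈ edgesWithin G Set.univ, A.kind e ≠ ArcKind.biarc := by
  obtain ⟨pos, page, slot, h⟩ := C.exists_twoPageLayout hgd C.n C.three_le le_rfl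
  have huniv : C.firstVertices C.n = Set.univ :=
    Set.eq_univ_of_forall fun x => (C.ord.symm x).isLt
  rw [huniv] at h
  exact h.exists_arcDiagram
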